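/- arXiv:2509.05284 — 5 statements merged into one kernel-verified Lean document; each statement's English description precedes it below -/
import Mathlib

section
/- Let K ≥ 1 and let (Φ_j)_{j≥1} be a sequence of real K×K matrices. Define the generalized impulse response (gir) coefficients Φ_j^{(h)} recursively by Φ_j^{(1)} = Φ_j and Φ_j^{(h+1)} = Φ_{j+1}^{(h)} + Φ_1^{(h)} Φ_j for all h ≥ 1, j ≥ 1. Then for all h ≥ 1 and j ≥ 1 the alternative representation Φ_j^{(h+1)} = Φ_{j+h} + Σ_{l=1}^{h} Φ_{h-l+1} Φ_j^{(l)} holds. -/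
/-- Generalized impulse response (gir) coefficients: `gir Φ h j` is `Φ_j^{(h)}`,
defined recursively by `Φ_j^{(1)} = Φ_j` and `Φ_j^{(h+1)} = Φ_{j+1}^{(h)} + Φ_1^{(h)} Φ_j`. -/
def gir {K : ℕ} (Φ : ℕ → Matrix (Fin K) (Fin K) ℝ) : ℕ → ℕ → Matrix (Fin K) (Fin K) ℝ
  | 0, _ => 0
  | 1, j => Φ j
  | h + 2, j => gir Φ (h + 1) (j + 1) + gir Φ (h + 1) 1 * Φ j

theorem gir_succ_eq_add_sum_range {K : ℕ} (Φ : ℕ → Matrix (Fin K) (Fin K) ℝ) (n j : ℕ) :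
    gir Φ (n + 1) j =
      Φ (j + n) + ∑ l ∈ Finset.range n, Φ (n - l) * gir Φ (l + 1) j := by
  induction n generalizing j with
  | zero => simp [gir]
  | succ n ih =>
    have hsum : ∑ l ∈ Finset.range n, Φ (n + 1 - (l + 1)) * gir Φ (l + 1 + 1) j =
        ∑ l ∈ Finset.range n, Φ (n - l) * gir Φ (l + 1) (j + 1) +
          (∑ l ∈ Finset.range n, Φ (n - l) * gir Φ (l + 1) 1) * Φ j := by
      rw [Finset.sum_mul, ← Finset.sum_add_distrib]
      refine Finset.sum_congr rfl fun l _ => ?_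
      rw [gir, Nat.add_sub_add_right, mul_add, mul_assoc]
    rw [gir, ih, ih, Finset.sum_range_succ', hsum, add_mul, add_comm 1 n, add_right_comm j 1 n]
    simp only [Nat.sub_zero, gir, add_assoc]
    abel

/-- The gir coefficients satisfy the alternative representation
`Φ_j^{(h+1)} = Φ_{j+h} + Σ_{l=1}^{h} Φ_{h-l+1} Φ_j^{(l)}` for all `h ≥ 1`, `j ≥ 1`. -/
theorem gir_alt_representation {K : ℕ} (hK : 1 ≤ K)
    (Φ : ℕ → Matrix (Fin K) (Fin K) ℝ) :
    ∀ h ≥ 1, ∀ j ≥ 1,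
      gir Φ (h + 1) j = Φ (j + h) + ∑ l ∈ Finset.Icc 1 h, Φ (h - l + 1) * gir Φ l j := by
  intro h _ j _
  rw [gir_succ_eq_add_sum_range, ← Finset.Ico_add_one_right_eq_Icc,
    Finset.sum_Ico_eq_sum_range, Nat.add_sub_cancel]
  refine congrArg _ (Finset.sum_congr rfl fun l hl => ?_)
  have hl' := Finset.mem_range.mp hl
  rw [show h - (1 + l) + 1 = h - l by lia, add_comm 1 l]
end

section
/- Let K ≥ 1, let (Φ_j)_{j≥1} be real K×K matrices with gir coefficients Φ_j^{(h)} defined recursively, let θ_0 ∈ ℝ^K, and define θ_m := Φ_1^{(m)} θ_0 for m ≥ 1. Then for all integers n, h with 1 ≤ n < h, the impulse response admits the horizon-n decomposition θ_h = Σ_{k=1}^{n} Φ_k^{(h-n)} θ_{n+1-k} + Φ_{n+1}^{(h-n)} θ_0; equivalently, the matrix identity Φ_1^{(h)} = Σ_{k=1}^{n} Φ_k^{(h-n)} Φ_1^{(n+1-k)} + Φ_{n+1}^{(h-n)} holds. -/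
/-- The one-step recursion of the gir coefficients at every horizon `m + 1`. -/
theorem gir_succ_succ {K : ℕ} (Φ : ℕ → Matrix (Fin K) (Fin K) ℝ) (m j : ℕ) :
    gir Φ (m + 2) j = gir Φ (m + 1) (j + 1) + gir Φ (m + 1) 1 * Φ j := by
  rw [gir]

theorem gir_one {K : ℕ} (Φ : ℕ → Matrix (Fin K) (Fin K) ℝ) (j : ℕ) : gir Φ 1 j = Φ j := by
  rw [gir]

/-- Horizon-`n` decomposition of `Φ_1^{(n+m+1)}`, with the sum indexed from zero. -/
theorem gir_add_one {K : ℕ} (Φ : ℕ → Matrix (Fin K) (Fin K) ℝ) (n m : ℕ) :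
    gir Φ (n + m + 1) 1 =
      (∑ k ∈ Finset.range n, gir Φ (m + 1) (k + 1) * gir Φ (n - k) 1)
        + gir Φ (m + 1) (n + 1) := by
  induction n generalizing m with
  | zero => simp
  | succ n ih =>
    have h_zero := ih 0
    simp only [add_zero, zero_add, gir_one] at h_zero
    rw [show n + 1 + m + 1 = n + (m + 1) + 1 by ring, ih (m + 1), Finset.sum_range_succ']
    simp only [gir_succ_succ, add_mul, Finset.sum_add_distrib, mul_assoc, ← Finset.mul_sum,
      Nat.add_sub_add_right, Nat.sub_zero, zero_add]
    rw [h_zero, mul_add]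
    abel

/-- Horizon-`n` decomposition of impulse responses: with `θ_m = Φ_1^{(m)} θ_0` for `m ≥ 1`,
for all `1 ≤ n < h` one has `θ_h = Σ_{k=1}^n Φ_k^{(h-n)} θ_{n+1-k} + Φ_{n+1}^{(h-n)} θ_0`;
equivalently `Φ_1^{(h)} = Σ_{k=1}^n Φ_k^{(h-n)} Φ_1^{(n+1-k)} + Φ_{n+1}^{(h-n)}`. -/
theorem irf_decomposition_horizon_n {K : ℕ} (hK : 1 ≤ K)
    (Φ : ℕ → Matrix (Fin K) (Fin K) ℝ)
    (θ : ℕ → Fin K → ℝ)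
    (hθ : ∀ m ≥ 1, θ m = (gir Φ m 1).mulVec (θ 0)) :
    ∀ n h : ℕ, 1 ≤ n → n < h →
      (θ h = (∑ k ∈ Finset.Icc 1 n, (gir Φ (h - n) k).mulVec (θ (n + 1 - k)))
              + (gir Φ (h - n) (n + 1)).mulVec (θ 0))
      ∧ gir Φ h 1 = (∑ k ∈ Finset.Icc 1 n, gir Φ (h - n) k * gir Φ (n + 1 - k) 1)
              + gir Φ (h - n) (n + 1) := by
  intro n h hn hnh
  have key : gir Φ h 1 = (∑ k ∈ Finset.Icc 1 n, gir Φ (h - n) k * gir Φ (n + 1 - k) 1)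
      + gir Φ (h - n) (n + 1) := by
    obtain ⟨m, rfl⟩ : ∃ m, h = n + m + 1 := ⟨h - n - 1, by omega⟩
    rw [show n + m + 1 - n = m + 1 by omega, gir_add_one,
      ← Finset.Ico_add_one_right_eq_Icc, Finset.sum_Ico_eq_sum_range]
    simp only [add_comm 1, Nat.add_sub_add_right, Nat.add_sub_cancel]
  refine ⟨?_, key⟩
  rw [hθ h (by omega), key, Matrix.add_mulVec, Matrix.sum_mulVec]
  congr 1
  refine Finset.sum_congr rfl fun k hk => ?_
  rw [Finset.mem_Icc] at hk
  rw [hθ (n + 1 - k) (by omega), Matrix.mulVec_mulVec]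
end

section
/- Let K ≥ 1, let (Φ_j)_{j≥1} be real K×K matrices with gir coefficients Φ_j^{(h)} defined recursively, let θ_0 ∈ ℝ^K, and define θ_m := Φ_1^{(m)} θ_0 for m ≥ 1. For 0 ≤ n < h and each coordinate i ∈ {1,…,K}, define the contribution of variable i at decomposition time n by θ_h^{(i,n)} := Σ_{k=1}^{n+1} c_i(Φ_k^{(h-n)}) · (θ_{n+1-k})_i, where c_i(A) denotes the i-th column of the matrix A and (v)_i the i-th component of the vector v. Then the impulse response decomposes exactly into the variable-specific contributions: Σ_{i=1}^{K} θ_h^{(i,n)} = θ_h. -/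
/-- The decomposition in matrix form: `θ_h = Σ_{k=0}^{n} Φ_{k+1}^{(p+1)} θ_{n-k}` for
`h = n + p + 1`. -/
theorem sum_range_gir_mulVec {K : ℕ} (Φ : ℕ → Matrix (Fin K) (Fin K) ℝ) (θ : ℕ → Fin K → ℝ)
    (hθ : ∀ m ≥ 1, θ m = (gir Φ m 1).mulVec (θ 0)) (n p : ℕ) :
    ∑ k ∈ Finset.range (n + 1), (gir Φ (p + 1) (k + 1)).mulVec (θ (n - k)) = θ (n + p + 1) := by
  induction n generalizing p with
  | zero => simpa using (hθ (p + 1) (by omega)).symm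
  | succ n ih =>
    have h₁ := ih 0
    have h₂ := ih (p + 1)
    simp only [gir, Matrix.add_mulVec, ← Matrix.mulVec_mulVec, Finset.sum_add_distrib,
      ← Matrix.mulVec_sum, add_zero] at h₁ h₂
    rw [h₁] at h₂
    rw [Finset.sum_range_succ']
    simp only [Nat.add_sub_add_right, zero_add, Nat.sub_zero]
    rw [h₂]
    congr 1
    omega

/-- Variable-specific decomposition of the impulse response: for `0 ≤ n < h`, the
contribution of variable `i` at decomposition time `n` is
`θ_h^{(i,n)} = Σ_{k=1}^{n+1} c_i(Φ_k^{(h-n)}) ⬝ (θ_{n+1-k})_i` (the `i`-th column of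
`Φ_k^{(h-n)}` times the `i`-th component of `θ_{n+1-k}`), and these contributions sum
exactly to the impulse response: `Σ_{i=1}^K θ_h^{(i,n)} = θ_h`. -/
theorem irf_variable_specific_decomposition {K : ℕ} (hK : 1 ≤ K)
    (Φ : ℕ → Matrix (Fin K) (Fin K) ℝ)
    (θ : ℕ → Fin K → ℝ)
    (hθ : ∀ m ≥ 1, θ m = (gir Φ m 1).mulVec (θ 0)) :
    ∀ n h : ℕ, n < h →
      ∑ i : Fin K,
        (∑ k ∈ Finset.Icc 1 (n + 1), fun r : Fin K => gir Φ (h - n) k r i * θ (n + 1 - k) i)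
        = θ h := by
  intro n h hnh
  obtain ⟨p, rfl⟩ : ∃ p, h = n + p + 1 := ⟨h - n - 1, by omega⟩
  rw [← sum_range_gir_mulVec Φ θ hθ n p, Finset.sum_comm, show n + p + 1 - n = p + 1 by omega,
    ← Finset.Ico_add_one_right_eq_Icc, Finset.sum_Ico_eq_sum_range]
  refine Finset.sum_congr (by simp) fun k _ => ?_
  ext r
  simp [Matrix.mulVec, dotProduct, add_comm 1 k]
end

section
/- There exist real 3×3 matrices Φ_1, …, Φ_6 (and Φ_j = 0 for j > 6) such that, with gir coefficients Φ_j^{(h)} defined recursively from (Φ_j)_{j≥1}, the (1,2)-entry of the first gir coefficient vanishes at the first five horizons, (Φ_1^{(h)})_{1,2} = 0 for h = 1, 2, 3, 4, 5, while (Φ_2^{(1)})_{1,2} ≠ 0. In words: there is a trivariate VAR(6) in which the Sims impulse response of the first variable to the second variable (under identity innovation covariance) is zero at horizons 1 through 5, yet the second variable Granger-causes the first at horizon 1, since some generalized impulse response coefficient is nonzero. -/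
/-- There is a trivariate VAR(6), i.e. real 3×3 matrices `Φ_1, …, Φ_6` with `Φ_j = 0` for
`j > 6`, such that the Sims impulse response of the first variable to the second
(under identity innovation covariance), namely the `(1,2)`-entry of the first gir
coefficient `(Φ_1^{(h)})_{1,2}`, vanishes at horizons `h = 1, …, 5`, while
`(Φ_2^{(1)})_{1,2} ≠ 0`, so the second variable Granger-causes the first at horizon 1.
(Coordinates are zero-based: the `(1,2)`-entry is the `(0,1)`-entry in `Fin 3`.) -/
theorem zero_irf_but_granger_causality :
    ∃ Φ : ℕ → Matrix (Fin 3) (Fin 3) ℝ,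
      (∀ j, 6 < j → Φ j = 0) ∧
      (∀ h ∈ Finset.Icc 1 5, gir Φ h 1 0 1 = 0) ∧
      gir Φ 1 2 0 1 ≠ 0 := by
  refine ⟨fun j => if j = 1 then !![0, 0, 1; 0, 0, 0; 0, 1, 0]
    else if j = 2 then !![0, -1, 0; 0, 0, 0; 0, 0, 0] else 0, ?_, ?_, ?_⟩
  · intro j hj
    simp [show j ≠ 1 by omega, show j ≠ 2 by omega]
  · intro h hh
    rw [Finset.mem_Icc] at hh
    obtain ⟨h1, h5⟩ := hh
    interval_cases h <;> simp [gir]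
  · simp [gir]
end

section
/- Let (Ω, 𝓕, P) be a probability space, let X : Ω → ℝ be a random variable taking values in {0,1}, let W : Ω → 𝒲 be a random variable with finite range, and let Y0, Y1 : Ω → ℝ be integrable random variables (the potential outcomes). Define the observed outcome Y := X·Y1 + (1−X)·Y0. Assume: (ignorability) for each x ∈ {0,1}, each j ∈ {0,1} and each w in the range of W, E[Y_x · 1{X=j} · 1{W=w}] · P(W=w) = E[Y_x · 1{W=w}] · P(X=j, W=w); and (positivity) P(X=x, W=w) > 0 for all x ∈ {0,1} and all w in the range of W. Then the average total effect is identified by the adjustment formula: E[Y1 − Y0] = Σ_{w} P(W=w) · ( E[Y·1{X=1, W=w}]/P(X=1, W=w) − E[Y·1{X=0, W=w}]/P(X=0, W=w) ), where the sum runs over the range of W. -/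
open MeasureTheory

/-- The law of total expectation for a random variable `W` with finite range. -/
theorem integral_eq_sum_setIntegral_fiber {Ω 𝒲 : Type*} [MeasurableSpace Ω] {P : Measure Ω}
    [Fintype 𝒲] [MeasurableSpace 𝒲] [MeasurableSingletonClass 𝒲] {W : Ω → 𝒲}
    (hW : Measurable W) {f : Ω → ℝ} (hf : Integrable f P) :
    ∫ ω, f ω ∂P = ∑ w : 𝒲, ∫ ω in {ω | W ω = w}, f ω ∂P := by
  rw [← setIntegral_univ, ← integral_iUnion_fintype (s := fun w => {ω | W ω = w})
    (fun w => hW (measurableSet_singleton w))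
    (fun v w hvw => Set.disjoint_left.2 fun ω hv hw => hvw (hv.symm.trans hw))
    (fun _ => hf.integrableOn)]
  congr 2
  ext ω
  simp

/-- Nonparametric identification of the average total effect by the adjustment formula.
`X` is a binary treatment (taking values in `{0,1}` inside `ℝ`), `W` pre-treatment
covariates with finite range, `Y0, Y1` integrable potential outcomes, and
`Y = X·Y1 + (1-X)·Y0` the observed outcome.  Under ignorability
(`E[Y_x · 1{X=j, W=w}] · P(W=w) = E[Y_x · 1{W=w}] · P(X=j, W=w)`) and positivity,
`E[Y1 - Y0] = Σ_w P(W=w) · (E[Y | X=1, W=w] - E[Y | X=0, W=w])`, where conditional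
expectations are ratios `E[Y·1_B]/P(B)`. -/
theorem total_effect_identification
    {Ω : Type*} [MeasurableSpace Ω] (P : Measure Ω) [IsProbabilityMeasure P]
    {𝒲 : Type*} [Fintype 𝒲] [MeasurableSpace 𝒲] [MeasurableSingletonClass 𝒲]
    (X : Ω → ℝ) (W : Ω → 𝒲) (Y0 Y1 : Ω → ℝ)
    (hX : Measurable X) (hW : Measurable W)
    (hXvals : ∀ ω, X ω = 0 ∨ X ω = 1)
    (hY0 : Integrable Y0 P) (hY1 : Integrable Y1 P)
    (Y : Ω → ℝ) (hY : ∀ ω, Y ω = X ω * Y1 ω + (1 - X ω) * Y0 ω)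
    (hIgn : ∀ Z : Ω → ℝ, (Z = Y0 ∨ Z = Y1) → ∀ j : ℝ, (j = 0 ∨ j = 1) → ∀ w : 𝒲,
      (∫ ω in {ω | X ω = j ∧ W ω = w}, Z ω ∂P) * (P {ω | W ω = w}).toReal
        = (∫ ω in {ω | W ω = w}, Z ω ∂P) * (P {ω | X ω = j ∧ W ω = w}).toReal)
    (hPos : ∀ x : ℝ, (x = 0 ∨ x = 1) → ∀ w : 𝒲,
      0 < (P {ω | X ω = x ∧ W ω = w}).toReal) :
    ∫ ω, (Y1 ω - Y0 ω) ∂P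
      = ∑ w : 𝒲, (P {ω | W ω = w}).toReal *
          ((∫ ω in {ω | X ω = 1 ∧ W ω = w}, Y ω ∂P)
              / (P {ω | X ω = 1 ∧ W ω = w}).toReal
            - (∫ ω in {ω | X ω = 0 ∧ W ω = w}, Y ω ∂P)
              / (P {ω | X ω = 0 ∧ W ω = w}).toReal) := by
  have hmeas (j : ℝ) (w : 𝒲) : MeasurableSet {ω | X ω = j ∧ W ω = w} :=
    (hX (measurableSet_singleton j)).inter (hW (measurableSet_singleton w))
  have hconsistent1 (w : 𝒲) : ∫ ω in {ω | X ω = 1 ∧ W ω = w}, Y ω ∂P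
      = ∫ ω in {ω | X ω = 1 ∧ W ω = w}, Y1 ω ∂P :=
    setIntegral_congr_fun (hmeas 1 w) fun ω hω => by simp [hY, hω.1]
  have hconsistent0 (w : 𝒲) : ∫ ω in {ω | X ω = 0 ∧ W ω = w}, Y ω ∂P
      = ∫ ω in {ω | X ω = 0 ∧ W ω = w}, Y0 ω ∂P :=
    setIntegral_congr_fun (hmeas 0 w) fun ω hω => by simp [hY, hω.1]
  rw [integral_eq_sum_setIntegral_fiber (f := fun ω => Y1 ω - Y0 ω) hW (hY1.sub hY0)]
  refine Finset.sum_congr rfl fun w _ => ?_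
  rw [integral_sub hY1.integrableOn hY0.integrableOn, hconsistent1, hconsistent0, mul_sub,
    mul_div_assoc', mul_div_assoc', mul_comm (P {ω | W ω = w}).toReal,
    mul_comm (P {ω | W ω = w}).toReal, hIgn Y1 (Or.inr rfl) 1 (Or.inr rfl) w,
    hIgn Y0 (Or.inl rfl) 0 (Or.inl rfl) w,
    mul_div_cancel_right₀ _ (hPos 1 (Or.inr rfl) w).ne',
    mul_div_cancel_right₀ _ (hPos 0 (Or.inl rfl) w).ne']
end
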